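/- For every t ∈ ℝ, the imaginary power (−Δ_d)^{it} of the discrete Laplacian, defined on ℓ^2(ℤ^d) as the Fourier multiplier operator with multiplier (4 Σ_{j=1}^d sin²(πξ_j))^{it}, extends to a bounded operator from ℓ^p(ℤ^d) to itself for all 1 < p < ∞. -/

import Mathlib

open MeasureTheory Real Complex

/-- The open unit cube `(0,1)^d` in `ℝ^d`. -/
noncomputable def unitCube (d : ℕ) : Set (Fin d → ℝ) :=
  Set.univ.pi fun _ => Set.Ioo (0 : ℝ) 1

/-- Discrete Fourier transform on `ℤ^d`: `F(f)(ξ) = ∑_{n ∈ ℤ^d} f(n) e^{2πi n·ξ}`. -/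
noncomputable def dft (d : ℕ) (f : (Fin d → ℤ) → ℂ) (ξ : Fin d → ℝ) : ℂ :=
  ∑' n : Fin d → ℤ, f n * Complex.exp (2 * Real.pi * Complex.I * ∑ i, (n i : ℂ) * (ξ i : ℂ))

/-- The Fourier multiplier operator `T_m`, given by `T_m f = F⁻¹(m · F(f))`. -/
noncomputable def Tmult (d : ℕ) (m : (Fin d → ℝ) → ℂ) (f : (Fin d → ℤ) → ℂ)
    (n : Fin d → ℤ) : ℂ :=
  ∫ ξ in unitCube d, m ξ * dft d f ξ *
    Complex.exp (-(2 * Real.pi * Complex.I) * ∑ i, (ξ i : ℂ) * (n i : ℂ))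

/-- The `ℓ^p(ℤ^d)` norm, as the `L^p` norm with respect to counting measure. -/
noncomputable def lpNorm (d : ℕ) (f : (Fin d → ℤ) → ℂ) (p : ℝ) : ENNReal :=
  eLpNorm f (ENNReal.ofReal p) (Measure.count : Measure (Fin d → ℤ))

/-- The symbol `(4 Σ_j sin²(πξ_j))^{it}` of the imaginary power `(−Δ_d)^{it}` of the
discrete Laplacian. -/
noncomputable def imagPowerSymbol (d : ℕ) (t : ℝ) (ξ : Fin d → ℝ) : ℂ :=
  ((4 * ∑ j, Real.sin (Real.pi * ξ j) ^ 2 : ℝ) : ℂ) ^ (Complex.I * (t : ℂ))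

/-- A Bellman-type function on the quadrant, of growth `x ^ (r + 1) + y ^ (1 + 1 / r)`, whose
Hessian dominates that of `± x * y`. -/
noncomputable def bellman (r x y : ℝ) : ℝ :=
  7 * r ^ 2 * y ^ (1 + 1 / r) + x ^ 2 * (x ^ r + y) ^ (1 - 1 / r)

lemma bellman_hessian_form_nonneg {r a m W h k κ σ : ℝ} (hr : 1 ≤ r) (ha : a * r = r - 1)
    (hm0 : 0 ≤ m) (hm1 : m ≤ 1) (hW : 0 < W) (hκ : κ ^ 2 * W ≤ k ^ 2 / W) (hσ : |σ| ≤ 1) :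
    0 ≤ 7 * k ^ 2 / W + W * (2 * h ^ 2 + 4 * a * h * (r * m * h + κ)
      + a * (a - 1) * (r * m * h + κ) ^ 2 + a * r * (r - 1) * m * h ^ 2) + 2 * σ * (h * k) := by
  have hr0 : 0 < r := by linarith
  have ha' : a = 1 - 1 / r := by field_simp; linarith
  have ha0 : 0 ≤ a := by rw [ha', sub_nonneg, div_le_one hr0]; exact hr
  have ha1 : a ≤ 1 := by rw [ha']; have : 0 < 1 / r := by positivity
                         linarith
  have h1 : h ^ 2 - 6 * κ ^ 2 ≤ 2 * h ^ 2 + 4 * a * h * (r * m * h + κ)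
      + a * (a - 1) * (r * m * h + κ) ^ 2 + a * r * (r - 1) * m * h ^ 2 := by
    have e1 : a * (a - 1) * (r * m * h + κ) ^ 2 ≥
        a * (a - 1) * (2 * (r * m * h) ^ 2 + 2 * κ ^ 2) := by
      have : a * (a - 1) ≤ 0 := by nlinarith
      nlinarith [sq_nonneg (r * m * h - κ)]
    have e2 : a * (a - 1) * (2 * (r * m * h) ^ 2) = - 2 * (r - 1) * (m * h) ^ 2 := by
      have : a * (a - 1) * r ^ 2 = -(r - 1) := by
        have : a * (a - 1) * r ^ 2 = (a * r) * (a * r - r) := by ring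
        rw [this, ha]; ring
      calc _ = 2 * (a * (a - 1) * r ^ 2) * (m * h) ^ 2 := by ring
        _ = _ := by rw [this]; ring
    have e3 : 4 * a * h * (r * m * h + κ) = 4 * (r - 1) * m * h ^ 2 + 4 * a * h * κ := by
      rw [← ha]; ring
    have e4 : 0 ≤ a * r * (r - 1) * m * h ^ 2 := by
      have : 0 ≤ r - 1 := by linarith
      positivity
    have e5 : (r - 1) * (m * h) ^ 2 ≤ (r - 1) * m * h ^ 2 := by
      have : 0 ≤ r - 1 := by linarith
      have : m ^ 2 ≤ m := by nlinarith
      have : m ^ 2 * h ^ 2 ≤ m * h ^ 2 := by gcongr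
      nlinarith
    have e6 : -(h ^ 2) - 4 * κ ^ 2 ≤ 4 * a * h * κ := by
      have : a ^ 2 ≤ 1 := by nlinarith
      have : a ^ 2 * κ ^ 2 ≤ 1 * κ ^ 2 := by gcongr
      nlinarith [sq_nonneg (h + 2 * a * κ)]
    have e7 : -(2 * κ ^ 2) ≤ a * (a - 1) * (2 * κ ^ 2) := by
      have : -1 ≤ a * (a - 1) := by nlinarith
      nlinarith [sq_nonneg κ]
    have e8 : 0 ≤ (r - 1) * m * h ^ 2 := by
      have : 0 ≤ r - 1 := by linarith
      positivity
    nlinarith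
  have h2 := mul_le_mul_of_nonneg_left h1 hW.le
  have h3 : -(W * h ^ 2 + k ^ 2 / W) ≤ 2 * σ * (h * k) := by
    have e1 : |σ * (h * k)| ≤ |h * k| := by
      rw [abs_mul]; nlinarith [abs_nonneg (h * k)]
    have e2 : 2 * |h * k| ≤ W * h ^ 2 + k ^ 2 / W := by
      have hq : W * h ^ 2 + k ^ 2 / W - 2 * |h * k| = (W * |h| - |k|) ^ 2 / W := by
        rw [abs_mul, ← sq_abs h, ← sq_abs k]; field_simp; ring
      have : 0 ≤ (W * |h| - |k|) ^ 2 / W := by positivity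
      linarith
    have := neg_abs_le (σ * (h * k))
    linarith
  have h4 : 7 * k ^ 2 / W = 7 * (k ^ 2 / W) := by ring
  rw [h4]
  nlinarith

lemma bellman_second_deriv_nonneg {r X Y h k σ : ℝ} (hr : 1 ≤ r) (hX : 0 < X) (hY : 0 < Y)
    (hσ : |σ| ≤ 1) :
    0 ≤ 7 * r ^ 2 * ((1 + 1 / r) * ((1 + 1 / r - 1) * Y ^ (1 + 1 / r - 1 - 1) * k) * k)
      + (2 * h ^ 2 * (X ^ r + Y) ^ (1 - 1 / r)
        + 4 * X * h * ((1 - 1 / r) * (X ^ r + Y) ^ (1 - 1 / r - 1) * (r * X ^ (r - 1) * h + k))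
        + X ^ 2 * ((1 - 1 / r) * ((1 - 1 / r - 1) * (X ^ r + Y) ^ (1 - 1 / r - 1 - 1) *
            (r * X ^ (r - 1) * h + k)) * (r * X ^ (r - 1) * h + k)
          + (1 - 1 / r) * (X ^ r + Y) ^ (1 - 1 / r - 1) *
            (r * ((r - 1) * X ^ (r - 1 - 1) * h) * h)))
      + 2 * σ * (h * k) := by
  have hr0 : 0 < r := by linarith
  set V := X ^ r with hV
  have hV0 : 0 < V := rpow_pos_of_pos hX r
  set S := V + Y with hS
  have hS0 : 0 < S := by positivity
  set a := 1 - 1 / r with ha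
  have har : a * r = r - 1 := by rw [ha]; field_simp
  set W := S ^ a with hW
  have hW0 : 0 < W := rpow_pos_of_pos hS0 a
  have ha0 : 0 ≤ a := by rw [ha, sub_nonneg, div_le_one hr0]; exact hr
  rw [rpow_sub_one hX.ne' (r - 1), rpow_sub_one hX.ne' r, rpow_sub_one hS0.ne' (a - 1),
    rpow_sub_one hS0.ne' a, ← hV, ← hW]
  have hXS : X ^ 2 * W ^ 2 ≤ S ^ 2 := by
    have h1 : X ≤ S ^ (1 / r) := by
      have : X = V ^ (1 / r) := by
        rw [hV, ← rpow_mul hX.le]; field_simp; simp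
      rw [this]
      gcongr
      linarith
    have h2 : X * W ≤ S := by
      calc X * W ≤ S ^ (1 / r) * S ^ a := by gcongr
        _ = S := by rw [← rpow_add hS0, ha]; simp
    calc X ^ 2 * W ^ 2 = (X * W) ^ 2 := by ring
      _ ≤ S ^ 2 := by gcongr
  have hYW : 1 / W ≤ Y ^ (1 + 1 / r - 1 - 1) := by
    have : (1 + 1 / r - 1 - 1) = -a := by rw [ha]; ring
    rw [this, hW, one_div, ← rpow_neg hS0.le]
    apply rpow_le_rpow_of_nonpos hY (by linarith) (by linarith)
  have key := bellman_hessian_form_nonneg (r := r) (a := a) (m := V / S) (W := W) (h := h) (k := k)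
    (κ := X * k / S) (σ := σ) hr har (by positivity) (by rw [div_le_one hS0]; linarith) hW0
    (by
      rw [div_pow, le_div_iff₀ hW0, div_mul_eq_mul_div, div_mul_eq_mul_div, div_le_iff₀ (by positivity)]
      nlinarith [mul_le_mul_of_nonneg_left hXS (sq_nonneg k)]) hσ
  have h7 : 7 * k ^ 2 / W ≤
      7 * r ^ 2 * ((1 + 1 / r) * ((1 + 1 / r - 1) * Y ^ (1 + 1 / r - 1 - 1) * k) * k) := by
    have e : 7 * r ^ 2 * ((1 + 1 / r) * ((1 + 1 / r - 1) * Y ^ (1 + 1 / r - 1 - 1) * k) * k)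
        = 7 * (r + 1) * k ^ 2 * Y ^ (1 + 1 / r - 1 - 1) := by
      generalize Y ^ (1 + 1 / r - 1 - 1) = Z
      field_simp
      ring
    rw [e, div_eq_mul_one_div]
    gcongr
    · nlinarith [sq_nonneg k]
  refine key.trans ?_
  have e2 : W * (2 * h ^ 2 + 4 * a * h * (r * (V / S) * h + X * k / S)
      + a * (a - 1) * (r * (V / S) * h + X * k / S) ^ 2 + a * r * (r - 1) * (V / S) * h ^ 2)
      = (2 * h ^ 2 * W
        + 4 * X * h * (a * (W / S) * (r * (V / X) * h + k))
        + X ^ 2 * (a * ((a - 1) * (W / S / S) * (r * (V / X) * h + k)) * (r * (V / X) * h + k)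
          + a * (W / S) * (r * ((r - 1) * (V / X / X) * h) * h))) := by
    field_simp
    ring
  rw [e2]
  linarith

lemma bellman_convex_on_line {r x y h k σ : ℝ} (hr : 1 ≤ r) (hx : 0 < x) (hy : 0 < y)
    (hx' : 0 < x + h) (hy' : 0 < y + k) (hσ : |σ| ≤ 1) :
    ConvexOn ℝ (Set.Icc (0 : ℝ) 1) fun τ =>
      bellman r (x + τ * h) (y + τ * k) + σ * ((x + τ * h) * (y + τ * k)) := by
  have hr0 : 0 < r := by linarith
  have ha0 : 0 ≤ 1 - 1 / r := by rw [sub_nonneg, div_le_one hr0]; exact hr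
  have hX : ∀ τ ∈ Set.Ioo (0 : ℝ) 1, 0 < x + τ * h := fun τ ht => by
    have : x + τ * h = (1 - τ) * x + τ * (x + h) := by ring
    rw [this]; have := ht.1; have := sub_pos.2 ht.2; positivity
  have hY : ∀ τ ∈ Set.Ioo (0 : ℝ) 1, 0 < y + τ * k := fun τ ht => by
    have : y + τ * k = (1 - τ) * y + τ * (y + k) := by ring
    rw [this]; have := ht.1; have := sub_pos.2 ht.2; positivity
  have dX : ∀ τ, HasDerivAt (fun τ => x + τ * h) h τ := fun τ => by
    simpa using ((hasDerivAt_id τ).mul_const h).const_add x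
  have dY : ∀ τ, HasDerivAt (fun τ => y + τ * k) k τ := fun τ => by
    simpa using ((hasDerivAt_id τ).mul_const k).const_add y
  refine convexOn_of_hasDerivWithinAt2_nonneg (convex_Icc 0 1)
    (f' := fun τ => 7 * r ^ 2 * ((1 + 1 / r) * (y + τ * k) ^ (1 + 1 / r - 1) * k)
      + (2 * (x + τ * h) * h * ((x + τ * h) ^ r + (y + τ * k)) ^ (1 - 1 / r)
        + (x + τ * h) ^ 2 * ((1 - 1 / r) * ((x + τ * h) ^ r + (y + τ * k)) ^ (1 - 1 / r - 1)
          * (r * (x + τ * h) ^ (r - 1) * h + k)))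
      + σ * (h * (y + τ * k) + (x + τ * h) * k))
    (f'' := fun τ => _) ?_ ?_ ?_
    (fun τ ht => bellman_second_deriv_nonneg (r := r) (X := x + τ * h) (Y := y + τ * k) (h := h)
      (k := k) (σ := σ) hr (hX τ (by simpa using ht)) (hY τ (by simpa using ht)) hσ)
  · apply Continuous.continuousOn
    unfold bellman
    have h1 : Continuous fun τ : ℝ => (y + τ * k) ^ (1 + 1 / r) :=
      Continuous.rpow_const (by fun_prop) fun _ => Or.inr (by positivity)
    have h2 : Continuous fun τ : ℝ => (x + τ * h) ^ r :=
      Continuous.rpow_const (by fun_prop) fun _ => Or.inr (by positivity)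
    have h3 : Continuous fun τ : ℝ => ((x + τ * h) ^ r + (y + τ * k)) ^ (1 - 1 / r) :=
      Continuous.rpow_const (by fun_prop) fun _ => Or.inr ha0
    fun_prop
  · intro τ ht
    rw [interior_Icc] at ht
    have hXτ := hX τ ht
    have hYτ := hY τ ht
    have hS : 0 < (x + τ * h) ^ r + (y + τ * k) := by positivity
    apply HasDerivAt.hasDerivWithinAt
    have d1 := (dY τ).rpow_const (p := 1 + 1 / r) (Or.inl hYτ.ne')
    have d2 := (dX τ).rpow_const (p := r) (Or.inl hXτ.ne')
    have d3 := (d2.add (dY τ)).rpow_const (p := 1 - 1 / r) (Or.inl hS.ne')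
    have d4 := ((dX τ).pow 2).mul d3
    convert! ((d1.const_mul (7 * r ^ 2)).add d4).add (((dX τ).mul (dY τ)).const_mul σ) using 1
    simp only [Pi.add_apply, Pi.pow_apply]
    push_cast
    ring
  · intro τ ht
    rw [interior_Icc] at ht
    have hXτ := hX τ ht
    have hYτ := hY τ ht
    have hS : 0 < (x + τ * h) ^ r + (y + τ * k) := by positivity
    apply HasDerivAt.hasDerivWithinAt
    have d1 := (dY τ).rpow_const (p := 1 + 1 / r - 1) (Or.inl hYτ.ne')
    have d2 := (dX τ).rpow_const (p := r) (Or.inl hXτ.ne')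
    have d2' := (dX τ).rpow_const (p := r - 1) (Or.inl hXτ.ne')
    have d3 := (d2.add (dY τ)).rpow_const (p := 1 - 1 / r) (Or.inl hS.ne')
    have d3' := (d2.add (dY τ)).rpow_const (p := 1 - 1 / r - 1) (Or.inl hS.ne')
    have d5 := (((d1.const_mul (1 + 1 / r)).mul_const k).const_mul (7 * r ^ 2))
    have d6 := (((dX τ).const_mul 2).mul_const h).mul d3
    have d7 := ((dX τ).pow 2).mul
      ((d3'.const_mul (1 - 1 / r)).mul (((d2'.const_mul r).mul_const h).add_const k))
    have d8 := ((((dY τ).const_mul h).add ((dX τ).mul_const k)).const_mul σ)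
    convert! (d5.add (d6.add d7)).add d8 using 1
    simp only [Pi.add_apply, Pi.pow_apply, Pi.mul_apply]
    push_cast
    ring

lemma continuous_bellman {r : ℝ} (hr : 1 ≤ r) : Continuous fun z : ℝ × ℝ => bellman r z.1 z.2 := by
  have hr0 : 0 < r := by linarith
  have ha0 : 0 ≤ 1 - 1 / r := by rw [sub_nonneg, div_le_one hr0]; exact hr
  unfold bellman
  have h1 : Continuous fun z : ℝ × ℝ => z.2 ^ (1 + 1 / r) :=
    Continuous.rpow_const (by fun_prop) fun _ => Or.inr (by positivity)
  have h2 : Continuous fun z : ℝ × ℝ => z.1 ^ r :=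
    Continuous.rpow_const (by fun_prop) fun _ => Or.inr (by positivity)
  have h3 : Continuous fun z : ℝ × ℝ => (z.1 ^ r + z.2) ^ (1 - 1 / r) :=
    Continuous.rpow_const (by fun_prop) fun _ => Or.inr ha0
  fun_prop

lemma bellman_convexOn {r σ : ℝ} (hr : 1 ≤ r) (hσ : |σ| ≤ 1) :
    ConvexOn ℝ (Set.Ici (0 : ℝ) ×ˢ Set.Ici (0 : ℝ)) fun z =>
      bellman r z.1 z.2 + σ * (z.1 * z.2) := by
  refine ⟨(convex_Ici 0).prod (convex_Ici 0), ?_⟩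
  rintro ⟨x, y⟩ ⟨hx, hy⟩ ⟨x', y'⟩ ⟨hx', hy'⟩ a b ha hb hab
  simp only [Set.mem_Ici] at hx hy hx' hy'
  have hc : Continuous fun z : ℝ × ℝ => bellman r z.1 z.2 + σ * (z.1 * z.2) :=
    (continuous_bellman hr).add (by fun_prop)
  set F := fun z : ℝ × ℝ => bellman r z.1 z.2 + σ * (z.1 * z.2) with hF
  have hε : ∀ ε : ℝ, 0 < ε → F (a * x + b * x' + ε, a * y + b * y' + ε)
      ≤ a * F (x + ε, y + ε) + b * F (x' + ε, y' + ε) := by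
    intro ε he
    have := (bellman_convex_on_line (x := x + ε) (y := y + ε) (h := x' - x) (k := y' - y) hr
      (by positivity) (by positivity) (by linarith) (by linarith) hσ).2
      (Set.left_mem_Icc.2 zero_le_one) (Set.right_mem_Icc.2 zero_le_one) ha hb hab
    have ha' : a = 1 - b := by linarith
    simp only [hF]
    simp only [smul_eq_mul, mul_zero, mul_one, zero_add, zero_mul, add_zero, one_mul] at this
    convert! this using 2 <;> subst ha' <;> ring_nf
  have hlim : ∀ u v : ℝ, Filter.Tendsto (fun ε : ℝ => F (u + ε, v + ε)) (nhdsWithin 0 (Set.Ioi 0))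
      (nhds (F (u, v))) := fun u v => by
    have : Continuous fun ε : ℝ => F (u + ε, v + ε) := hc.comp (by fun_prop)
    have h0 := this.tendsto 0
    simp only [add_zero] at h0
    exact h0.mono_left nhdsWithin_le_nhds
  have := le_of_tendsto_of_tendsto (hlim (a * x + b * x') (a * y + b * y'))
    (((hlim x y).const_mul a).add ((hlim x' y').const_mul b))
    (eventually_nhdsWithin_of_forall fun ε he => hε ε he)
  simpa using this

lemma bellman_nonneg {r x y : ℝ} (hr : 1 ≤ r) (hx : 0 ≤ x) (hy : 0 ≤ y) : 0 ≤ bellman r x y := by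
  unfold bellman; positivity

lemma bellman_le {r x y : ℝ} (hr : 1 ≤ r) (hx : 0 ≤ x) (hy : 0 ≤ y) :
    bellman r x y ≤ (7 * r ^ 2 + 4) * (x ^ (r + 1) + y ^ (1 + 1 / r)) := by
  have hr0 : 0 < r := by linarith
  have ha0 : 0 ≤ 1 - 1 / r := by rw [sub_nonneg, div_le_one hr0]; exact hr
  have hV : 0 ≤ x ^ r := by positivity
  have hS : 0 ≤ x ^ r + y := by positivity
  have h1 : x ≤ (x ^ r + y) ^ (1 / r) := by
    calc x = (x ^ r) ^ (1 / r) := by rw [← rpow_mul hx]; field_simp; simp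
      _ ≤ _ := by gcongr; linarith
  have h2 : x ^ 2 * (x ^ r + y) ^ (1 - 1 / r) ≤ (x ^ r + y) ^ (1 + 1 / r) := by
    calc x ^ 2 * (x ^ r + y) ^ (1 - 1 / r)
        ≤ ((x ^ r + y) ^ (1 / r)) ^ 2 * (x ^ r + y) ^ (1 - 1 / r) := by gcongr
      _ = (x ^ r + y) ^ (1 + 1 / r) := by
        rw [sq, ← rpow_add_of_nonneg hS (by positivity) (by positivity),
          ← rpow_add_of_nonneg hS (by positivity) ha0]
        congr 1; ring
  have hq : (2 : ℝ) ^ (1 + 1 / r) ≤ 4 := by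
    have : 1 / r ≤ 1 := by rw [div_le_one hr0]; exact hr
    calc (2 : ℝ) ^ (1 + 1 / r) ≤ 2 ^ (2 : ℝ) := by gcongr <;> linarith
      _ = 4 := by norm_num
  have hVp : (x ^ r) ^ (1 + 1 / r) = x ^ (r + 1) := by
    rw [← rpow_mul hx]; congr 1; field_simp
  have hx0 : 0 ≤ x ^ (r + 1) := by positivity
  have hy0 : 0 ≤ y ^ (1 + 1 / r) := by positivity
  have h3 : (x ^ r + y) ^ (1 + 1 / r) ≤ 4 * (x ^ (r + 1) + y ^ (1 + 1 / r)) := by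
    rcases le_total (x ^ r) y with h | h
    · calc (x ^ r + y) ^ (1 + 1 / r) ≤ (2 * y) ^ (1 + 1 / r) := by gcongr; linarith
        _ = 2 ^ (1 + 1 / r) * y ^ (1 + 1 / r) := mul_rpow (by norm_num) hy
        _ ≤ 4 * y ^ (1 + 1 / r) := by gcongr
        _ ≤ _ := by linarith
    · calc (x ^ r + y) ^ (1 + 1 / r) ≤ (2 * x ^ r) ^ (1 + 1 / r) := by gcongr; linarith
        _ = 2 ^ (1 + 1 / r) * x ^ (r + 1) := by rw [mul_rpow (by norm_num) hV, hVp]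
        _ ≤ 4 * x ^ (r + 1) := by gcongr
        _ ≤ _ := by linarith
  unfold bellman
  have : 0 ≤ 7 * r ^ 2 * x ^ (r + 1) := by positivity
  linarith

section Walk

variable {ι G E : Type*} [Fintype ι] [AddCommGroup G]

/-- The averaging operator of the random walk on `G` with steps `v i` of weight `w i`. -/
noncomputable def walk [AddCommGroup E] [Module ℝ E] (w : ι → ℝ) (v : ι → G) (u : G → E) (n : G) :
    E :=
  ∑ i, w i • u (n + v i)

variable {w : ι → ℝ} {v : ι → G} {f h : G → ℝ} {r : ℝ}

lemma walk_nonneg (hw : ∀ i, 0 ≤ w i) (hf : ∀ n, 0 ≤ f n) (n : G) : 0 ≤ walk w v f n :=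
  Finset.sum_nonneg fun i _ => mul_nonneg (hw i) (hf _)

lemma hasSum_walk (hf : Summable f) : HasSum (walk w v f) (∑ i, w i * ∑' n, f n) :=
  hasSum_sum fun i _ => ((Equiv.addRight (v i)).hasSum_iff.2 hf.hasSum).mul_left (w i)

lemma tsum_walk (hw : ∑ i, w i = 1) (hf : Summable f) : ∑' n, walk w v f n = ∑' n, f n := by
  rw [(hasSum_walk hf).tsum_eq, ← Finset.sum_mul, hw, one_mul]

lemma abs_walk_mul_sub_le (hr : 1 ≤ r) (hw : ∀ i, 0 ≤ w i) (hw1 : ∑ i, w i = 1)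
    (hf : ∀ n, 0 ≤ f n) (hh : ∀ n, 0 ≤ h n) (n : G) :
    |walk w v (fun n => f n * h n) n - walk w v f n * walk w v h n| ≤
      walk w v (fun n => bellman r (f n) (h n)) n - bellman r (walk w v f n) (walk w v h n) := by
  have key : ∀ σ : ℝ, |σ| ≤ 1 →
      bellman r (walk w v f n) (walk w v h n) + σ * (walk w v f n * walk w v h n)
        ≤ walk w v (fun n => bellman r (f n) (h n)) n + σ * walk w v (fun n => f n * h n) n := by
    intro σ hσ
    have := (bellman_convexOn hr hσ).map_sum_le (t := Finset.univ) (w := w)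
      (p := fun i => (f (n + v i), h (n + v i))) (fun i _ => hw i) hw1
      (fun i _ => ⟨hf _, hh _⟩)
    have e1 : (∑ i, w i • (f (n + v i), h (n + v i))) = (walk w v f n, walk w v h n) := by
      simp [walk, Prod.ext_iff, Prod.fst_sum, Prod.snd_sum]
    rw [e1] at this
    refine this.trans (le_of_eq ?_)
    simp only [walk, smul_eq_mul, mul_add, Finset.sum_add_distrib, Finset.mul_sum]
    congr 1
    exact Finset.sum_congr rfl fun i _ => by ring
  have h1 := key 1 (by simp)
  have h2 := key (-1) (by simp)
  rw [abs_le]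
  constructor <;> linarith

lemma sum_abs_tsum_walk_mul_sub_le (hr : 1 ≤ r) (hw : ∀ i, 0 ≤ w i) (hw1 : ∑ i, w i = 1)
    (hf : ∀ n, 0 ≤ f n) (hh : ∀ n, 0 ≤ h n) (hs : Summable fun n => f n * h n)
    (hB : Summable fun n => bellman r (f n) (h n)) (N : ℕ) :
    ∑ j ∈ Finset.range N, |∑' n, (walk w v)^[j] f n * (walk w v)^[j] h n
      - ∑' n, (walk w v)^[j + 1] f n * (walk w v)^[j + 1] h n| ≤
    ∑' n, bellman r (f n) (h n) := by
  induction N generalizing f h with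
  | zero => simpa using tsum_nonneg fun n => bellman_nonneg hr (hf n) (hh n)
  | succ N ih =>
    have hPf := walk_nonneg (v := v) hw hf
    have hPh := walk_nonneg (v := v) hw hh
    have hgap := abs_walk_mul_sub_le (v := v) hr hw hw1 hf hh
    have hPs := (hasSum_walk (w := w) (v := v) hs).summable
    have hPB := (hasSum_walk (w := w) (v := v) hB).summable
    have hB' : Summable fun n => bellman r (walk w v f n) (walk w v h n) :=
      Summable.of_nonneg_of_le (fun n => bellman_nonneg hr (hPf n) (hPh n))
        (fun n => by have := (abs_nonneg _).trans (hgap n); linarith) hPB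
    have hgs : Summable fun n =>
        walk w v (fun n => f n * h n) n - walk w v f n * walk w v h n :=
      Summable.of_norm_bounded (hPB.sub hB') hgap
    have hs' : Summable fun n => walk w v f n * walk w v h n := by
      simpa using hPs.sub hgs
    rw [Finset.sum_range_succ']
    have h1 := ih hPf hPh hs' hB'
    simp only [← Function.iterate_succ_apply] at h1
    have h2 : |∑' n, f n * h n - ∑' n, walk w v f n * walk w v h n| ≤
        ∑' n, bellman r (f n) (h n) - ∑' n, bellman r (walk w v f n) (walk w v h n) := by
      rw [← tsum_walk (v := v) hw1 hs, ← tsum_walk (v := v) hw1 hB, ← hPs.tsum_sub hs',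
        ← hPB.tsum_sub hB']
      rw [← Real.norm_eq_abs]
      exact tsum_of_norm_bounded (hPB.sub hB').hasSum fun n => hgap n
    simp only [Function.iterate_zero, id_eq, zero_add, Function.iterate_one]
    linarith

lemma walk_support_finite (hh : h.support.Finite) : (walk w v h).support.Finite := by
  refine Set.Finite.subset (Set.finite_iUnion fun i : ι =>
    hh.preimage (f := fun n => n + v i) (add_left_injective (v i)).injOn) fun n hn => ?_
  obtain ⟨i, -, hi⟩ := Finset.exists_ne_zero_of_sum_ne_zero hn
  exact Set.mem_iUnion.2 ⟨i, right_ne_zero_of_mul hi⟩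

lemma tsum_walk_mul (σ : ι ≃ ι) (hσw : ∀ i, w (σ i) = w i) (hσv : ∀ i, v (σ i) = -v i)
    (hh : h.support.Finite) : ∑' n, walk w v f n * h n = ∑' n, f n * walk w v h n := by
  have hs : ∀ i, Summable fun n => w i * (f (n + v i) * h n) := fun i =>
    summable_of_hasFiniteSupport (hh.subset fun n hn =>
      right_ne_zero_of_mul (right_ne_zero_of_mul hn))
  have hs' : ∀ i, Summable fun n => w i * (f n * h (n + v i)) := fun i =>
    summable_of_hasFiniteSupport ((hh.preimage (f := fun n => n + v i)
      (add_left_injective (v i)).injOn).subset fun n hn =>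
        right_ne_zero_of_mul (right_ne_zero_of_mul hn))
  have e1 : ∀ n, walk w v f n * h n = ∑ i, w i * (f (n + v i) * h n) := fun n => by
    simp [walk, Finset.sum_mul, mul_assoc]
  have e2 : ∀ n, f n * walk w v h n = ∑ i, w i * (f n * h (n + v i)) := fun n => by
    simp only [walk, Finset.mul_sum, smul_eq_mul]
    exact Finset.sum_congr rfl fun i _ => by ring
  simp only [e1, e2]
  rw [Summable.tsum_finsetSum fun i _ => hs i, Summable.tsum_finsetSum fun i _ => hs' i,
    ← Equiv.sum_comp σ]
  refine Finset.sum_congr rfl fun i _ => ?_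
  rw [← (Equiv.addRight (v i)).tsum_eq]
  simp [hσw, hσv]

lemma tsum_walk_iterate_mul (σ : ι ≃ ι) (hσw : ∀ i, w (σ i) = w i) (hσv : ∀ i, v (σ i) = -v i)
    (hh : h.support.Finite) (k : ℕ) :
    ∑' n, (walk w v)^[k] f n * h n = ∑' n, f n * (walk w v)^[k] h n := by
  induction k generalizing h with
  | zero => rfl
  | succ k ih =>
    rw [Function.iterate_succ_apply', tsum_walk_mul σ hσw hσv hh, ih (walk_support_finite hh),
      ← Function.iterate_succ_apply]

lemma norm_sum_tsum_walk_le_bellman (hr : 1 ≤ r) (hw : ∀ i, 0 ≤ w i) (hw1 : ∑ i, w i = 1)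
    (hf : ∀ n, 0 ≤ f n) (hh : ∀ n, 0 ≤ h n) (hs : Summable fun n => f n * h n)
    (hp : Summable fun n => f n ^ (r + 1)) (hq : Summable fun n => h n ^ (1 + 1 / r))
    {c : ℕ → ℂ} {A : ℝ} (hc : ∀ j, ‖c j‖ ≤ A) (N : ℕ) :
    ‖∑ j ∈ Finset.range N, c j * ((∑' n, (walk w v)^[j] f n * (walk w v)^[j] h n
      - ∑' n, (walk w v)^[j + 1] f n * (walk w v)^[j + 1] h n : ℝ) : ℂ)‖ ≤
      A * (7 * r ^ 2 + 4) * (∑' n, f n ^ (r + 1) + ∑' n, h n ^ (1 + 1 / r)) := by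
  have hA : 0 ≤ A := (norm_nonneg _).trans (hc 0)
  have hle := fun n => bellman_le hr (hf n) (hh n)
  have hB : Summable fun n => bellman r (f n) (h n) :=
    Summable.of_nonneg_of_le (fun n => bellman_nonneg hr (hf n) (hh n)) hle
      ((hp.add hq).mul_left _)
  have hB' : ∑' n, bellman r (f n) (h n) ≤
      (7 * r ^ 2 + 4) * (∑' n, f n ^ (r + 1) + ∑' n, h n ^ (1 + 1 / r)) := by
    rw [← hp.tsum_add hq, ← tsum_mul_left]
    exact hB.tsum_le_tsum hle ((hp.add hq).mul_left _)
  calc _ ≤ A * ∑' n, bellman r (f n) (h n) := by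
        refine le_trans ?_ (mul_le_mul_of_nonneg_left
          (sum_abs_tsum_walk_mul_sub_le (v := v) hr hw hw1 hf hh hs hB N) hA)
        rw [Finset.mul_sum]
        refine norm_sum_le_of_le _ fun j _ => ?_
        rw [norm_mul, Complex.norm_real, Real.norm_eq_abs]
        gcongr
        exact hc j
    _ ≤ _ := by rw [mul_assoc]; gcongr

lemma norm_sum_tsum_walk_le {p : ℝ} (hp1 : 1 < p) :
    ∃ C : ℝ, 0 < C ∧ ∀ {ι G : Type} [Fintype ι] [AddCommGroup G] (w : ι → ℝ) (v : ι → G)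
      (σ : ι ≃ ι) (_ : ∀ i, w (σ i) = w i) (_ : ∀ i, v (σ i) = -v i)
      (_ : ∀ i, 0 ≤ w i) (_ : ∑ i, w i = 1) (f h : G → ℝ)
      (_ : ∀ n, 0 ≤ f n) (_ : ∀ n, 0 ≤ h n) (_ : h.support.Finite)
      (_ : Summable fun n => f n ^ p) (c : ℕ → ℂ) (A : ℝ) (_ : ∀ j, ‖c j‖ ≤ A) (N : ℕ),
      ‖∑ j ∈ Finset.range N, c j * ((∑' n, (walk w v)^[2 * j] f n * h n
        - ∑' n, (walk w v)^[2 * (j + 1)] f n * h n : ℝ) : ℂ)‖ ≤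
        A * C * (∑' n, f n ^ p + ∑' n, h n ^ (p / (p - 1))) := by
  have hp0 : 0 < p - 1 := by linarith
  have hq0 : 0 < p / (p - 1) := by positivity
  have hsplit : ∀ {ι G : Type} [Fintype ι] [AddCommGroup G] (w : ι → ℝ) (v : ι → G)
      (σ : ι ≃ ι) (_ : ∀ i, w (σ i) = w i) (_ : ∀ i, v (σ i) = -v i) (f h : G → ℝ)
      (_ : h.support.Finite) (j : ℕ), ∑' n, (walk w v)^[2 * j] f n * h n =
        ∑' n, (walk w v)^[j] f n * (walk w v)^[j] h n := by
    intro ι G _ _ w v σ hσw hσv f h hh j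
    rw [two_mul, Function.iterate_add_apply, tsum_walk_iterate_mul σ hσw hσv hh]
  have hfin : ∀ {G : Type} {h : G → ℝ} {s : ℝ}, s ≠ 0 → h.support.Finite →
      Summable fun n => h n ^ s := fun hs hh =>
    summable_of_hasFiniteSupport (hh.subset fun n hn hn0 => hn (by simp [hn0, hs]))
  have hsum : ∀ {G : Type} (f : G → ℝ) {h : G → ℝ}, h.support.Finite →
      Summable fun n => f n * h n := fun f h hh =>
    summable_of_hasFiniteSupport (hh.subset fun n hn => right_ne_zero_of_mul hn)
  rcases le_total 2 p with h2 | h2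
  · refine ⟨7 * (p - 1) ^ 2 + 4, by positivity, ?_⟩
    intro ι G _ _ w v σ hσw hσv hw hw1 f h hf hh hhs hfp c A hc N
    simp only [hsplit w v σ hσw hσv f h hhs]
    have e1 : p - 1 + 1 = p := by ring
    have e2 : 1 + 1 / (p - 1) = p / (p - 1) := by field_simp; ring
    have := norm_sum_tsum_walk_le_bellman (v := v) (r := p - 1) (by linarith) hw hw1 hf hh
      (hsum f hhs) (by rwa [e1]) (hfin (by rw [e2]; exact hq0.ne') hhs) hc N
    rwa [e1, e2] at this
  · refine ⟨7 * (1 / (p - 1)) ^ 2 + 4, by positivity, ?_⟩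
    intro ι G _ _ w v σ hσw hσv hw hw1 f h hf hh hhs hfp c A hc N
    simp only [hsplit w v σ hσw hσv f h hhs]
    have e1 : 1 + 1 / (1 / (p - 1)) = p := by simp
    have e2 : 1 / (p - 1) + 1 = p / (p - 1) := by field_simp; ring
    have := norm_sum_tsum_walk_le_bellman (v := v) (r := 1 / (p - 1))
      (by rw [le_div_iff₀ hp0]; linarith) hw hw1 hh hf
      (by simpa only [mul_comm] using hsum f hhs)
      (hfin (by rw [e2]; exact hq0.ne') hhs) (by rwa [e1]) hc N
    rw [e1, e2] at this
    simpa only [mul_comm, add_comm] using this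

end Walk

section FourierMultiplier

variable {d : ℕ} {m : (Fin d → ℝ) → ℂ} {f : (Fin d → ℤ) → ℂ} {B : ℝ}

lemma norm_cexp_two_pi (n : Fin d → ℤ) (ξ : Fin d → ℝ) :
    ‖cexp (2 * Real.pi * Complex.I * ∑ i, (n i : ℂ) * (ξ i : ℂ))‖ = 1 := by
  have : (2 * Real.pi * Complex.I * ∑ i, (n i : ℂ) * (ξ i : ℂ))
      = ((2 * Real.pi * ∑ i, (n i : ℝ) * ξ i : ℝ) : ℂ) * Complex.I := by
    push_cast; ring
  rw [this, Complex.norm_exp_ofReal_mul_I]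

lemma norm_cexp_neg_two_pi (n : Fin d → ℤ) (ξ : Fin d → ℝ) :
    ‖cexp (-(2 * Real.pi * Complex.I) * ∑ i, (ξ i : ℂ) * (n i : ℂ))‖ = 1 := by
  have : (-(2 * Real.pi * Complex.I) * ∑ i, (ξ i : ℂ) * (n i : ℂ))
      = ((-(2 * Real.pi * ∑ i, ξ i * (n i : ℝ)) : ℝ) : ℂ) * Complex.I := by
    push_cast; ring
  rw [this, Complex.norm_exp_ofReal_mul_I]

lemma summable_dft (hf : Summable fun n => ‖f n‖) (ξ : Fin d → ℝ) :
    Summable fun n : Fin d → ℤ =>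
      f n * cexp (2 * Real.pi * Complex.I * ∑ i, (n i : ℂ) * (ξ i : ℂ)) :=
  Summable.of_norm <| by simpa only [norm_mul, norm_cexp_two_pi, mul_one] using hf

lemma norm_dft_le (hf : Summable fun n => ‖f n‖) (ξ : Fin d → ℝ) :
    ‖dft d f ξ‖ ≤ ∑' n, ‖f n‖ :=
  tsum_of_norm_bounded hf.hasSum fun n => by rw [norm_mul, norm_cexp_two_pi, mul_one]

lemma continuous_dft (hf : Summable fun n => ‖f n‖) : Continuous (dft d f) :=
  continuous_tsum (fun n => by fun_prop) hf fun n ξ => by rw [norm_mul, norm_cexp_two_pi, mul_one]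

instance isProbabilityMeasure_unitCube (d : ℕ) :
    IsProbabilityMeasure ((volume : Measure (Fin d → ℝ)).restrict (unitCube d)) :=
  ⟨by simp [unitCube, volume_pi_pi]⟩

lemma norm_multiplier_integrand_le (hb : ∀ ξ, ‖m ξ‖ ≤ B) (hf : Summable fun n => ‖f n‖)
    (n : Fin d → ℤ) (ξ : Fin d → ℝ) :
    ‖m ξ * dft d f ξ * cexp (-(2 * Real.pi * Complex.I) * ∑ i, (ξ i : ℂ) * (n i : ℂ))‖
      ≤ B * ∑' n, ‖f n‖ := by
  rw [norm_mul, norm_mul, norm_cexp_neg_two_pi, mul_one]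
  exact mul_le_mul (hb ξ) (norm_dft_le hf ξ) (norm_nonneg _) ((norm_nonneg _).trans (hb ξ))

lemma measurable_multiplier_integrand (hm : Measurable m) (hf : Summable fun n => ‖f n‖)
    (n : Fin d → ℤ) :
    Measurable fun ξ => m ξ * dft d f ξ *
      cexp (-(2 * Real.pi * Complex.I) * ∑ i, (ξ i : ℂ) * (n i : ℂ)) :=
  (hm.mul (continuous_dft hf).measurable).mul (Continuous.measurable (by fun_prop))

lemma integrable_multiplier_integrand (hm : Measurable m) (hb : ∀ ξ, ‖m ξ‖ ≤ B)
    (hf : Summable fun n => ‖f n‖) (n : Fin d → ℤ) :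
    Integrable (fun ξ => m ξ * dft d f ξ *
      cexp (-(2 * Real.pi * Complex.I) * ∑ i, (ξ i : ℂ) * (n i : ℂ)))
      ((volume : Measure (Fin d → ℝ)).restrict (unitCube d)) :=
  Integrable.of_bound (measurable_multiplier_integrand hm hf n).aestronglyMeasurable
    (B * ∑' n, ‖f n‖) (Filter.Eventually.of_forall (norm_multiplier_integrand_le hb hf n))

lemma tendsto_Tmult {M : ℕ → (Fin d → ℝ) → ℂ} (hM : ∀ N, Measurable (M N))
    (hb : ∀ᶠ N in Filter.atTop, ∀ ξ, ‖M N ξ‖ ≤ B)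
    (hlim : ∀ ξ, Filter.Tendsto (fun N => M N ξ) Filter.atTop (nhds (m ξ)))
    (hf : Summable fun n => ‖f n‖) (n : Fin d → ℤ) :
    Filter.Tendsto (fun N => Tmult d (M N) f n) Filter.atTop (nhds (Tmult d m f n)) := by
  refine tendsto_integral_filter_of_dominated_convergence (fun _ => B * ∑' n, ‖f n‖)
    (Filter.Eventually.of_forall fun N =>
      (measurable_multiplier_integrand (hM N) hf n).aestronglyMeasurable)
    (hb.mono fun N hN => Filter.Eventually.of_forall (norm_multiplier_integrand_le hN hf n))
    (integrable_const _)
    (Filter.Eventually.of_forall fun ξ => ((hlim ξ).mul_const _).mul_const _)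

lemma Tmult_sum_symbol {κ : Type*} (s : Finset κ) (a : κ → ℂ) (M : κ → (Fin d → ℝ) → ℂ)
    (hM : ∀ k, Measurable (M k)) (hb : ∀ k ξ, ‖M k ξ‖ ≤ B) (hf : Summable fun n => ‖f n‖)
    (n : Fin d → ℤ) :
    Tmult d (fun ξ => ∑ k ∈ s, a k * M k ξ) f n = ∑ k ∈ s, a k * Tmult d (M k) f n := by
  simp only [Tmult, ← integral_const_mul]
  rw [← integral_finsetSum _ fun k _ =>
    (integrable_multiplier_integrand (hM k) (hb k) hf n).const_mul (a k)]
  refine integral_congr_ae (Filter.Eventually.of_forall fun ξ => ?_)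
  simp only [Finset.sum_mul, mul_assoc]

lemma Tmult_sum_function {κ : Type*} (s : Finset κ) (a : κ → ℂ) (g : κ → (Fin d → ℤ) → ℂ)
    (hm : Measurable m) (hb : ∀ ξ, ‖m ξ‖ ≤ B) (hg : ∀ k, Summable fun n => ‖g k n‖)
    (n : Fin d → ℤ) :
    Tmult d m (fun n => ∑ k ∈ s, a k * g k n) n = ∑ k ∈ s, a k * Tmult d m (g k) n := by
  simp only [Tmult, ← integral_const_mul]
  rw [← integral_finsetSum _ fun k _ =>
    (integrable_multiplier_integrand hm hb (hg k) n).const_mul (a k)]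
  refine integral_congr_ae (Filter.Eventually.of_forall fun ξ => ?_)
  have : dft d (fun n => ∑ k ∈ s, a k * g k n) ξ = ∑ k ∈ s, a k * dft d (g k) ξ := by
    simp only [dft, ← tsum_mul_left, Finset.sum_mul, mul_assoc]
    exact Summable.tsum_finsetSum fun k _ => by
      simpa only [mul_assoc] using (summable_dft (hg k) ξ).mul_left (a k)
  simp only [this, Finset.mul_sum, Finset.sum_mul]
  exact Finset.sum_congr rfl fun k _ => by ring

lemma integral_unitCube_cexp (k : Fin d → ℤ) :
    ∫ ξ in unitCube d, cexp (2 * Real.pi * Complex.I * ∑ i, (k i : ℂ) * (ξ i : ℂ)) =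
      if k = 0 then 1 else 0 := by
  have h1 : ∀ ξ : Fin d → ℝ, cexp (2 * Real.pi * Complex.I * ∑ i, (k i : ℂ) * (ξ i : ℂ)) =
      ∏ i, cexp (2 * Real.pi * Complex.I * k i * (ξ i : ℂ)) := fun ξ => by
    rw [Finset.mul_sum, Complex.exp_sum]
    exact Finset.prod_congr rfl fun i _ => by ring_nf
  have h2 : ∀ j : ℤ, ∫ x in Set.Ioo (0 : ℝ) 1, cexp (2 * Real.pi * Complex.I * j * (x : ℂ)) =
      if j = 0 then 1 else 0 := fun j => by
    rw [← integral_Ioc_eq_integral_Ioo, ← intervalIntegral.integral_of_le zero_le_one]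
    split_ifs with hj
    · simp [hj]
    · have hc : 2 * (Real.pi : ℂ) * Complex.I * j ≠ 0 := by
        simp [Real.pi_ne_zero, hj]
      rw [integral_exp_mul_complex hc]
      have : cexp (2 * Real.pi * Complex.I * j * ((1 : ℝ) : ℂ)) = 1 := by
        rw [Complex.exp_eq_one_iff]; exact ⟨j, by push_cast; ring⟩
      rw [this]; simp
  simp only [h1]
  rw [unitCube, volume_pi, Measure.restrict_pi_pi,
    integral_fintype_prod_eq_prod (f := fun i (x : ℝ) => cexp (2 * Real.pi * Complex.I * k i * x))]
  simp only [h2]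
  split_ifs with hk
  · simp [hk]
  · obtain ⟨i, hi⟩ := Function.ne_iff.1 hk
    exact Finset.prod_eq_zero (Finset.mem_univ i) (if_neg hi)

lemma Tmult_one (hf : Summable fun n => ‖f n‖) (n : Fin d → ℤ) :
    Tmult d (fun _ => 1) f n = f n := by
  have h1 : ∀ (k : Fin d → ℤ) (ξ : Fin d → ℝ),
      f k * cexp (2 * Real.pi * Complex.I * ∑ i, (k i : ℂ) * (ξ i : ℂ)) *
        cexp (-(2 * Real.pi * Complex.I) * ∑ i, (ξ i : ℂ) * (n i : ℂ)) =
      f k * cexp (2 * Real.pi * Complex.I * ∑ i, ((k - n) i : ℂ) * (ξ i : ℂ)) := fun k ξ => by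
    rw [mul_assoc, ← Complex.exp_add]
    congr 2
    simp only [Pi.sub_apply, Int.cast_sub, sub_mul, Finset.sum_sub_distrib, mul_sub, neg_mul]
    simp only [mul_comm (ξ _ : ℂ), sub_eq_add_neg]
  have h2 : ∀ ξ : Fin d → ℝ, 1 * dft d f ξ *
      cexp (-(2 * Real.pi * Complex.I) * ∑ i, (ξ i : ℂ) * (n i : ℂ)) =
      ∑' k, f k * cexp (2 * Real.pi * Complex.I * ∑ i, ((k - n) i : ℂ) * (ξ i : ℂ)) := fun ξ => by
    rw [one_mul, dft, ← tsum_mul_right]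
    exact tsum_congr fun k => h1 k ξ
  simp only [Tmult, h2]
  rw [← integral_tsum_of_summable_integral_norm]
  · simp only [integral_const_mul, integral_unitCube_cexp, sub_eq_zero]
    simp
  · intro k
    refine Integrable.of_bound (Continuous.aestronglyMeasurable (by fun_prop)) ‖f k‖ ?_
    exact Filter.Eventually.of_forall fun ξ => by rw [norm_mul, norm_cexp_two_pi, mul_one]
  · simp only [norm_mul, norm_cexp_two_pi, mul_one, integral_const, probReal_univ, one_smul]
    exact hf

variable {ι : Type*} [Fintype ι] {w : ι → ℝ} {v : ι → Fin d → ℤ} {ρ : (Fin d → ℝ) → ℂ}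

lemma Tmult_mul_eq_walk (hρ : ∀ ξ, ρ ξ = ∑ i, (w i : ℂ) *
      cexp (-(2 * Real.pi * Complex.I) * ∑ j, (ξ j : ℂ) * (v i j : ℂ)))
    (hm : Measurable m) (hb : ∀ ξ, ‖m ξ‖ ≤ B) (hf : Summable fun n => ‖f n‖) :
    Tmult d (fun ξ => ρ ξ * m ξ) f = walk w v (Tmult d m f) := by
  ext n
  simp only [walk, Tmult, Complex.real_smul, ← integral_const_mul]
  rw [← integral_finsetSum _ fun i _ =>
    (integrable_multiplier_integrand hm hb hf (n + v i)).const_mul (w i : ℂ)]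
  refine integral_congr_ae (Filter.Eventually.of_forall fun ξ => ?_)
  simp only [hρ, Finset.sum_mul]
  refine Finset.sum_congr rfl fun i _ => ?_
  have : cexp (-(2 * Real.pi * Complex.I) * ∑ j, (ξ j : ℂ) * ((n + v i) j : ℂ)) =
      cexp (-(2 * Real.pi * Complex.I) * ∑ j, (ξ j : ℂ) * (n j : ℂ)) *
      cexp (-(2 * Real.pi * Complex.I) * ∑ j, (ξ j : ℂ) * (v i j : ℂ)) := by
    rw [← Complex.exp_add, ← mul_add, ← Finset.sum_add_distrib]
    simp [mul_add]
  rw [this]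
  ring

lemma Tmult_pow_eq_walk (hρ : ∀ ξ, ρ ξ = ∑ i, (w i : ℂ) *
      cexp (-(2 * Real.pi * Complex.I) * ∑ j, (ξ j : ℂ) * (v i j : ℂ)))
    (hρm : Measurable ρ) (hρ1 : ∀ ξ, ‖ρ ξ‖ ≤ 1) (hf : Summable fun n => ‖f n‖) (k : ℕ) :
    Tmult d (fun ξ => ρ ξ ^ k) f = (walk w v)^[k] f := by
  induction k with
  | zero => ext n; simpa using Tmult_one hf n
  | succ k ih =>
    simp only [pow_succ']
    rw [Tmult_mul_eq_walk hρ (hρm.pow_const k) (B := 1)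
      (fun ξ => by rw [norm_pow]; exact pow_le_one₀ (norm_nonneg _) (hρ1 ξ)) hf, ih,
      Function.iterate_succ_apply']

lemma walk_iterate_ofReal (u : (Fin d → ℤ) → ℝ) (k : ℕ) :
    (walk w v)^[k] (fun n => (u n : ℂ)) = fun n => (((walk w v)^[k] u n : ℝ) : ℂ) := by
  induction k with
  | zero => rfl
  | succ k ih =>
    rw [Function.iterate_succ_apply', ih, Function.iterate_succ_apply']
    ext n
    simp [walk]

end FourierMultiplier

/-- The Taylor coefficients of `(1 - z) ^ (I * t - 1)`. -/
noncomputable def imagPowerCoeff (t : ℝ) (j : ℕ) : ℂ :=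
  Ring.choose ((1 - Complex.I * t) + j - 1) j

lemma hasSum_imagPowerCoeff (t : ℝ) {x : ℝ} (hx0 : 0 ≤ x) (hx1 : x < 1) :
    HasSum (fun j => imagPowerCoeff t j * (x : ℂ) ^ j)
      (1 / (1 - (x : ℂ)) ^ (1 - Complex.I * t)) := by
  have := (Complex.one_div_one_sub_cpow_hasFPowerSeriesOnBall_zero (1 - Complex.I * t)).hasSum
    (y := (x : ℂ)) (by
      rw [← ENNReal.ofReal_one, Metric.eball_ofReal]
      simpa [abs_of_nonneg hx0] using hx1)
  simpa [imagPowerCoeff, mul_comm] using this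

lemma imagPowerCoeff_succ (t : ℝ) (j : ℕ) :
    imagPowerCoeff t (j + 1) = imagPowerCoeff t j * ((1 - Complex.I * t + j) / (j + 1)) := by
  have h : ∀ j : ℕ, (j.factorial : ℂ) * imagPowerCoeff t j =
      (ascPochhammer ℂ j).eval (1 - Complex.I * t) := fun j => by
    rw [imagPowerCoeff, ← Ring.multichoose_eq, ← nsmul_eq_mul,
      Ring.factorial_nsmul_multichoose_eq_ascPochhammer, Polynomial.ascPochhammer_smeval_eq_eval]
  have h1 := h (j + 1)
  rw [ascPochhammer_succ_eval, ← h j, Nat.factorial_succ] at h1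
  have hj : (j.factorial : ℂ) ≠ 0 := by exact_mod_cast j.factorial_ne_zero
  have hj' : (j : ℂ) + 1 ≠ 0 := by exact_mod_cast j.succ_ne_zero
  field_simp
  push_cast at h1
  apply mul_left_cancel₀ hj
  linear_combination h1

lemma exists_norm_imagPowerCoeff_le (t : ℝ) : ∃ A : ℝ, ∀ j, ‖imagPowerCoeff t j‖ ≤ A := by
  have hs : Summable fun i : ℕ => t ^ 2 / ((i : ℝ) + 1) ^ 2 := by
    have := (summable_nat_add_iff 1).2 (Real.summable_one_div_nat_pow.2 one_lt_two)
    simpa [div_eq_mul_inv] using this.mul_left (t ^ 2)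
  refine ⟨Real.exp (∑' i : ℕ, t ^ 2 / ((i : ℝ) + 1) ^ 2), fun j => ?_⟩
  refine le_trans (b := Real.exp (∑ i ∈ Finset.range j, t ^ 2 / ((i : ℝ) + 1) ^ 2)) ?_
    (Real.exp_le_exp.2 (hs.sum_le_tsum _ fun i _ => by positivity))
  induction j with
  | zero => simp [imagPowerCoeff]
  | succ j ih =>
    rw [imagPowerCoeff_succ, norm_mul, Finset.sum_range_succ, Real.exp_add]
    refine mul_le_mul ih ?_ (norm_nonneg _) (Real.exp_pos _).le
    have hj : (0 : ℝ) < j + 1 := by positivity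
    have h1 : ‖(1 - Complex.I * t + j) / ((j : ℂ) + 1)‖ ^ 2 = 1 + t ^ 2 / ((j : ℝ) + 1) ^ 2 := by
      have e : ((j : ℂ) + 1) = (((j : ℝ) + 1 : ℝ) : ℂ) := by push_cast; rfl
      rw [norm_div, div_pow, e, Complex.norm_real, Real.norm_of_nonneg hj.le, Complex.sq_norm,
        Complex.normSq_apply]
      simp
      field_simp
      ring
    have h2 : 0 ≤ t ^ 2 / ((j : ℝ) + 1) ^ 2 := by positivity
    calc ‖(1 - Complex.I * t + j) / ((j : ℂ) + 1)‖
        ≤ 1 + t ^ 2 / ((j : ℝ) + 1) ^ 2 := by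
          nlinarith [norm_nonneg ((1 - Complex.I * t + j) / ((j : ℂ) + 1))]
      _ ≤ _ := by rw [add_comm]; exact Real.add_one_le_exp _

lemma tendsto_sum_imagPowerCoeff {t : ℝ} (ht : t ≠ 0) {x : ℝ} (hx : |x| ≤ 1) :
    Filter.Tendsto (fun N => ∑ j ∈ Finset.range N, imagPowerCoeff t j *
      ((x : ℂ) ^ (2 * j) - (x : ℂ) ^ (2 * (j + 1)))) Filter.atTop
      (nhds (((1 - x ^ 2 : ℝ) : ℂ) ^ (Complex.I * (t : ℂ)))) := by
  have hx2 : x ^ 2 ≤ 1 := (sq_le_one_iff_abs_le_one x).2 hx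
  rcases hx2.eq_or_lt with h | h
  · have h' : (x : ℂ) ^ 2 = 1 := by exact_mod_cast h
    simp [pow_mul, h', h, ht, Complex.zero_cpow]
  · have hs := ((hasSum_imagPowerCoeff t (sq_nonneg x) h).mul_right
      (1 - ((x ^ 2 : ℝ) : ℂ))).tendsto_sum_nat
    convert hs using 2
    · refine Finset.sum_congr rfl fun j _ => ?_
      push_cast
      ring
    · have h0 : ((1 - x ^ 2 : ℝ) : ℂ) ≠ 0 := by
        exact_mod_cast (sub_pos.2 h).ne'
      have e : (1 : ℂ) - ((x ^ 2 : ℝ) : ℂ) = ((1 - x ^ 2 : ℝ) : ℂ) := by push_cast; ring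
      rw [e, Complex.cpow_sub _ _ h0, Complex.cpow_one]
      field_simp

lemma norm_sum_imagPowerCoeff_le {t A : ℝ} (hA : ∀ j, ‖imagPowerCoeff t j‖ ≤ A) {x : ℝ}
    (hx : |x| ≤ 1) (N : ℕ) :
    ‖∑ j ∈ Finset.range N, imagPowerCoeff t j *
      ((x : ℂ) ^ (2 * j) - (x : ℂ) ^ (2 * (j + 1)))‖ ≤ A := by
  have hA0 : 0 ≤ A := (norm_nonneg _).trans (hA 0)
  have hx2 : x ^ 2 ≤ 1 := (sq_le_one_iff_abs_le_one x).2 hx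
  calc _ ≤ ∑ j ∈ Finset.range N, A * ((x ^ 2) ^ j - (x ^ 2) ^ (j + 1)) := by
        refine norm_sum_le_of_le _ fun j _ => ?_
        have e : (x : ℂ) ^ (2 * j) - (x : ℂ) ^ (2 * (j + 1)) =
            (((x ^ 2) ^ j - (x ^ 2) ^ (j + 1) : ℝ) : ℂ) := by
          push_cast; ring
        have h0 : 0 ≤ (x ^ 2) ^ j - (x ^ 2) ^ (j + 1) :=
          sub_nonneg.2 (pow_le_pow_of_le_one (sq_nonneg x) hx2 j.le_succ)
        rw [norm_mul, e, Complex.norm_real, Real.norm_of_nonneg h0]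
        exact mul_le_mul_of_nonneg_right (hA j) h0
    _ = A * (1 - (x ^ 2) ^ N) := by
        rw [← Finset.mul_sum, Finset.sum_range_sub' (fun j => (x ^ 2) ^ j), pow_zero]
    _ ≤ A * 1 := by gcongr; linarith [pow_nonneg (sq_nonneg x) N]
    _ = A := mul_one A

section DiscreteLaplacian

variable {d : ℕ}

/-- The symbol of `-Δ`. -/
noncomputable def laplacianSymbol (d : ℕ) (ξ : Fin d → ℝ) : ℝ :=
  4 * ∑ j, Real.sin (Real.pi * ξ j) ^ 2

lemma laplacianSymbol_nonneg (ξ : Fin d → ℝ) : 0 ≤ laplacianSymbol d ξ := by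
  unfold laplacianSymbol; positivity

lemma laplacianSymbol_le (ξ : Fin d → ℝ) : laplacianSymbol d ξ ≤ 4 * d := by
  unfold laplacianSymbol
  have : ∑ j, Real.sin (Real.pi * ξ j) ^ 2 ≤ ∑ _j : Fin d, (1 : ℝ) :=
    Finset.sum_le_sum fun j _ => Real.sin_sq_le_one _
  simp at this
  linarith

lemma continuous_laplacianSymbol : Continuous (laplacianSymbol d) := by
  unfold laplacianSymbol; fun_prop

/-- The steps of the lazy nearest-neighbour walk on `ℤ ^ d`. -/
def lazyStep (d : ℕ) : Option (Fin d × Bool) → Fin d → ℤ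
  | none => 0
  | some (j, true) => Pi.single j 1
  | some (j, false) => -Pi.single j 1

/-- The weights of the lazy nearest-neighbour walk on `ℤ ^ d` with generator `c • Δ`. -/
def lazyWeight (d : ℕ) (c : ℝ) : Option (Fin d × Bool) → ℝ
  | none => 1 - 2 * d * c
  | some _ => c

lemma lazyWeight_nonneg {c : ℝ} (hc0 : 0 ≤ c) (hc : 2 * d * c ≤ 1) (i : Option (Fin d × Bool)) :
    0 ≤ lazyWeight d c i := by
  cases i with
  | none => simpa [lazyWeight] using hc
  | some _ => exact hc0

lemma sum_lazyWeight (c : ℝ) : ∑ i, lazyWeight d c i = 1 := by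
  simp [Fintype.sum_option, lazyWeight]
  ring

/-- The involution of the steps of the lazy walk given by negation. -/
def lazyReverse (d : ℕ) : Option (Fin d × Bool) ≃ Option (Fin d × Bool) :=
  Equiv.optionCongr (Equiv.prodCongr (Equiv.refl _) Equiv.boolNot)

lemma lazyWeight_reverse (c : ℝ) (i : Option (Fin d × Bool)) :
    lazyWeight d c (lazyReverse d i) = lazyWeight d c i := by
  cases i <;> rfl

lemma lazyStep_reverse (i : Option (Fin d × Bool)) :
    lazyStep d (lazyReverse d i) = -lazyStep d i := by
  match i with
  | none => simp [lazyStep, lazyReverse]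
  | some (j, true) => simp [lazyStep, lazyReverse]
  | some (j, false) => simp [lazyStep, lazyReverse]

lemma lazySymbol_eq (c : ℝ) (ξ : Fin d → ℝ) :
    ((1 - c * laplacianSymbol d ξ : ℝ) : ℂ) = ∑ i, (lazyWeight d c i : ℂ) *
      cexp (-(2 * Real.pi * Complex.I) * ∑ j, (ξ j : ℂ) * (lazyStep d i j : ℂ)) := by
  have h : ∀ x : ℝ, cexp (-(2 * Real.pi * Complex.I) * x) + cexp (2 * Real.pi * Complex.I * x) =
      ((2 - 4 * Real.sin (Real.pi * x) ^ 2 : ℝ) : ℂ) := fun x => by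
    have e : 2 - 4 * Real.sin (Real.pi * x) ^ 2 = 2 * Real.cos (2 * (Real.pi * x)) := by
      rw [Real.cos_two_mul, Real.sin_sq]; ring
    rw [e, Complex.ofReal_mul, Complex.ofReal_cos, Complex.ofReal_ofNat, Complex.two_cos,
      add_comm]
    push_cast
    ring_nf
  have h1 : ∀ x : Fin d, ∑ j, (ξ j : ℂ) * ((Pi.single x (1 : ℤ) : Fin d → ℤ) j : ℂ) = ξ x :=
    fun x => by
      rw [Finset.sum_eq_single x] <;> simp +contextual
  rw [Fintype.sum_option, Fintype.sum_prod_type]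
  simp only [Fintype.sum_bool, lazyWeight, lazyStep, Pi.zero_apply, Pi.neg_apply, Int.cast_neg,
    Int.cast_zero, mul_zero, Finset.sum_const_zero, Complex.exp_zero, mul_one, mul_neg,
    Finset.sum_neg_distrib, h1, neg_mul, neg_neg, ← mul_add]
  have h2 : ∀ x : Fin d, cexp (-(2 * Real.pi * Complex.I * ξ x)) +
      cexp (2 * Real.pi * Complex.I * ξ x) =
      ((2 - 4 * Real.sin (Real.pi * ξ x) ^ 2 : ℝ) : ℂ) := fun x => by
    rw [← h, neg_mul]
  simp only [h2, ← Finset.mul_sum, ← Complex.ofReal_sum, ← Complex.ofReal_mul,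
    ← Complex.ofReal_add]
  congr 1
  simp [laplacianSymbol, Finset.sum_sub_distrib, ← Finset.mul_sum]
  ring

lemma Tmult_sub {m m' : (Fin d → ℝ) → ℂ} {f : (Fin d → ℤ) → ℂ} {B : ℝ} (hm : Measurable m)
    (hm' : Measurable m') (hb : ∀ ξ, ‖m ξ‖ ≤ B) (hb' : ∀ ξ, ‖m' ξ‖ ≤ B)
    (hf : Summable fun n => ‖f n‖) (n : Fin d → ℤ) :
    Tmult d (fun ξ => m ξ - m' ξ) f n = Tmult d m f n - Tmult d m' f n := by
  simp only [Tmult]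
  rw [← integral_sub (integrable_multiplier_integrand hm hb hf n)
    (integrable_multiplier_integrand hm' hb' hf n)]
  simp only [sub_mul]

lemma summable_rpow_of_summable {α : Type*} {f : α → ℝ} {p : ℝ} (hp : 1 ≤ p) (hf : ∀ n, 0 ≤ f n)
    (hs : Summable f) : Summable fun n => f n ^ p := by
  refine Summable.of_norm_bounded_eventually hs ?_
  filter_upwards [hs.tendsto_cofinite_zero.eventually_le_const zero_lt_one] with n hn
  rw [Real.norm_of_nonneg (rpow_nonneg (hf n) p)]
  exact (rpow_le_rpow_of_exponent_ge_of_imp (hf n) hn hp (by intros; linarith)).trans_eq (rpow_one _)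

lemma norm_tsum_mul_le_of_tendsto {u : ℕ → (Fin d → ℤ) → ℂ} {g h : (Fin d → ℤ) → ℂ} {K : ℝ}
    (hh : h.support.Finite) (hu : ∀ n, Filter.Tendsto (fun N => u N n) Filter.atTop (nhds (g n)))
    (hK : ∀ N, ‖∑' n, u N n * h n‖ ≤ K) : ‖∑' n, g n * h n‖ ≤ K := by
  have e : ∀ g : (Fin d → ℤ) → ℂ, ∑' n, g n * h n = ∑ n ∈ hh.toFinset, g n * h n := fun g =>
    tsum_eq_sum fun n hn => by simp_all
  simp only [e] at hK ⊢
  exact le_of_tendsto (tendsto_finsetSum _ fun n _ => (hu n).mul_const (h n)).norm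
    (Filter.Eventually.of_forall hK)

/-- The lazy-walk symbol powers act by iterates of the walk. -/
lemma Tmult_lazySymbol_pow {c : ℝ} (hc0 : 0 ≤ c) (hc : 2 * d * c ≤ 1) {f : (Fin d → ℤ) → ℝ}
    (hf : Summable fun n => ‖(f n : ℂ)‖) (k : ℕ) (n : Fin d → ℤ) :
    Tmult d (fun ξ => ((1 - c * laplacianSymbol d ξ : ℝ) : ℂ) ^ k) (fun n => (f n : ℂ)) n =
      ((walk (lazyWeight d c) (lazyStep d))^[k] f n : ℝ) := by
  have hcont := continuous_laplacianSymbol (d := d)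
  rw [Tmult_pow_eq_walk (lazySymbol_eq c) (Continuous.measurable (by fun_prop)) ?_ hf,
    walk_iterate_ofReal]
  intro ξ
  rw [Complex.norm_real, Real.norm_eq_abs, abs_le]
  have h0 := mul_nonneg hc0 (laplacianSymbol_nonneg ξ)
  have h1 := mul_le_mul_of_nonneg_left (laplacianSymbol_le ξ) hc0
  constructor <;> linarith

lemma abs_lazySymbol_le {c : ℝ} (hc0 : 0 ≤ c) (hc : 2 * d * c ≤ 1) (ξ : Fin d → ℝ) :
    |1 - c * laplacianSymbol d ξ| ≤ 1 := by
  have h0 := mul_nonneg hc0 (laplacianSymbol_nonneg ξ)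
  have h1 := mul_le_mul_of_nonneg_left (laplacianSymbol_le ξ) hc0
  rw [abs_le]
  constructor <;> linarith

lemma tsum_Tmult_partial_sum {c : ℝ} (hc0 : 0 ≤ c) (hc : 2 * d * c ≤ 1) {f h : (Fin d → ℤ) → ℝ}
    (hf : Summable fun n => ‖(f n : ℂ)‖) (hh : h.support.Finite) (κ : ℕ → ℂ) (N : ℕ) :
    ∑' n, Tmult d (fun ξ => ∑ j ∈ Finset.range N, κ j *
      (((1 - c * laplacianSymbol d ξ : ℝ) : ℂ) ^ (2 * j)
        - ((1 - c * laplacianSymbol d ξ : ℝ) : ℂ) ^ (2 * (j + 1)))) (fun n => (f n : ℂ)) n * h n =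
    ∑ j ∈ Finset.range N, κ j *
      ((∑' n, (walk (lazyWeight d c) (lazyStep d))^[2 * j] f n * h n
        - ∑' n, (walk (lazyWeight d c) (lazyStep d))^[2 * (j + 1)] f n * h n : ℝ) : ℂ) := by
  have hcont := continuous_laplacianSymbol (d := d)
  have hm : ∀ k : ℕ, Measurable fun ξ : Fin d → ℝ =>
      ((1 - c * laplacianSymbol d ξ : ℝ) : ℂ) ^ k := fun k => Continuous.measurable (by fun_prop)
  have hb : ∀ (k : ℕ) (ξ : Fin d → ℝ), ‖((1 - c * laplacianSymbol d ξ : ℝ) : ℂ) ^ k‖ ≤ 1 :=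
    fun k ξ => by
      rw [norm_pow, Complex.norm_real]
      exact pow_le_one₀ (norm_nonneg _) (abs_lazySymbol_le hc0 hc ξ)
  have e : ∀ u : (Fin d → ℤ) → ℝ, ∑' n, u n * h n = ∑ n ∈ hh.toFinset, u n * h n := fun g =>
    tsum_eq_sum fun n hn => by simp_all
  have e' : ∀ u : (Fin d → ℤ) → ℂ, ∑' n, u n * h n = ∑ n ∈ hh.toFinset, u n * h n := fun g =>
    tsum_eq_sum fun n hn => by simp_all
  simp only [e, e']
  have hT : ∀ n, Tmult d (fun ξ => ∑ j ∈ Finset.range N, κ j *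
      (((1 - c * laplacianSymbol d ξ : ℝ) : ℂ) ^ (2 * j)
        - ((1 - c * laplacianSymbol d ξ : ℝ) : ℂ) ^ (2 * (j + 1)))) (fun n => (f n : ℂ)) n =
      ∑ j ∈ Finset.range N, κ j *
        ((((walk (lazyWeight d c) (lazyStep d))^[2 * j] f n : ℝ) : ℂ) -
          (((walk (lazyWeight d c) (lazyStep d))^[2 * (j + 1)] f n : ℝ) : ℂ)) := fun n => by
    rw [Tmult_sum_symbol (Finset.range N) κ (fun j ξ =>
      ((1 - c * laplacianSymbol d ξ : ℝ) : ℂ) ^ (2 * j)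
        - ((1 - c * laplacianSymbol d ξ : ℝ) : ℂ) ^ (2 * (j + 1)))
      (fun j => (hm _).sub (hm _)) (B := 1 + 1)
      (fun j ξ => (norm_sub_le _ _).trans (add_le_add (hb _ ξ) (hb _ ξ))) hf]
    refine Finset.sum_congr rfl fun j _ => ?_
    rw [Tmult_sub (hm _) (hm _) (hb _) (hb _) hf, Tmult_lazySymbol_pow hc0 hc hf,
      Tmult_lazySymbol_pow hc0 hc hf]
  simp only [hT, Finset.sum_mul]
  rw [Finset.sum_comm]
  refine Finset.sum_congr rfl fun j _ => ?_
  push_cast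
  rw [← Finset.sum_sub_distrib, Finset.mul_sum]
  exact Finset.sum_congr rfl fun n _ => by ring

lemma tendsto_imagPower_approx (t : ℝ) (x : ℝ) (hx : 0 ≤ x) {c : ℕ → ℝ} (hc : ∀ M, 0 < c M)
    (hx1 : ∀ M, c M * x ≤ 1) (hlim : Filter.Tendsto c Filter.atTop (nhds 0)) :
    Filter.Tendsto (fun M => ((2 * c M : ℝ) : ℂ) ^ (-(Complex.I * (t : ℂ))) *
      ((1 - (1 - c M * x) ^ 2 : ℝ) : ℂ) ^ (Complex.I * (t : ℂ))) Filter.atTop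
      (nhds ((x : ℂ) ^ (Complex.I * (t : ℂ)))) := by
  have h1 : ∀ M, ((2 * c M : ℝ) : ℂ) ^ (-(Complex.I * (t : ℂ))) *
      ((1 - (1 - c M * x) ^ 2 : ℝ) : ℂ) ^ (Complex.I * (t : ℂ)) =
      (x : ℂ) ^ (Complex.I * (t : ℂ)) *
        ((1 - c M * x / 2 : ℝ) : ℂ) ^ (Complex.I * (t : ℂ)) := fun M => by
    have e : 1 - (1 - c M * x) ^ 2 = 2 * c M * (x * (1 - c M * x / 2)) := by ring
    have hp : 0 ≤ 1 - c M * x / 2 := by linarith [hx1 M]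
    have h2c : 0 < 2 * c M := by linarith [hc M]
    rw [e, Complex.ofReal_mul (2 * c M), Complex.mul_cpow_ofReal_nonneg h2c.le (by positivity),
      Complex.ofReal_mul x, Complex.mul_cpow_ofReal_nonneg hx hp, Complex.cpow_neg, ← mul_assoc,
      inv_mul_cancel₀ (by simp [Complex.cpow_eq_zero_iff, (hc M).ne']), one_mul]
  simp only [h1]
  have h2 : Filter.Tendsto (fun M => ((1 - c M * x / 2 : ℝ) : ℂ)) Filter.atTop (nhds 1) := by
    have : Filter.Tendsto (fun M => 1 - c M * x / 2) Filter.atTop (nhds 1) := by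
      simpa using ((hlim.mul_const x).div_const 2).const_sub 1
    have h := (Complex.continuous_ofReal.tendsto 1).comp this
    rwa [Complex.ofReal_one] at h
  have h3 := (h2.cpow tendsto_const_nhds (b := Complex.I * (t : ℂ))
    (Or.inl (by simp))).const_mul ((x : ℂ) ^ (Complex.I * (t : ℂ)))
  rwa [Complex.one_cpow, mul_one] at h3

lemma norm_cpow_I_mul_le (x t : ℝ) (hx : 0 ≤ x) : ‖(x : ℂ) ^ (Complex.I * (t : ℂ))‖ ≤ 1 := by
  rcases hx.eq_or_lt with rfl | hx
  · by_cases ht : t = 0 <;> simp [ht, Complex.zero_cpow]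
  · rw [Complex.norm_cpow_eq_rpow_re_of_pos hx]; simp

lemma exists_norm_tsum_Tmult_le_of_nonneg (d : ℕ) {t : ℝ} (ht : t ≠ 0) {p : ℝ} (hp : 1 < p) :
    ∃ C : ℝ, 0 < C ∧ ∀ f h : (Fin d → ℤ) → ℝ, (∀ n, 0 ≤ f n) → (∀ n, 0 ≤ h n) → Summable f →
      h.support.Finite → ‖∑' n, Tmult d (imagPowerSymbol d t) (fun n => (f n : ℂ)) n * h n‖ ≤
        C * (∑' n, f n ^ p + ∑' n, h n ^ (p / (p - 1))) := by
  obtain ⟨C, hC, hbound⟩ := norm_sum_tsum_walk_le hp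
  obtain ⟨A, hA⟩ := exists_norm_imagPowerCoeff_le t
  have hA0 : 0 ≤ A := (norm_nonneg _).trans (hA 0)
  refine ⟨(A + 1) * C, by positivity, fun f h hf hh hfs hhs => ?_⟩
  have hcont := continuous_laplacianSymbol (d := d)
  have hfs' : Summable fun n => ‖(f n : ℂ)‖ := by
    simpa only [Complex.norm_real] using hfs.norm
  have hhs' : (fun n => (h n : ℂ)).support.Finite := by simpa [Function.support] using hhs
  set K := (A + 1) * C * (∑' n, f n ^ p + ∑' n, h n ^ (p / (p - 1))) with hK
  set c : ℕ → ℝ := fun M => 1 / (((M : ℝ) + 1) * (4 * d + 1)) with hc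
  have hcpos : ∀ M, 0 < c M := fun M => by simp only [hc]; positivity
  have hc4 : ∀ M, c M * (4 * d) ≤ 1 := fun M => by
    simp only [hc]
    rw [div_mul_eq_mul_div, div_le_one (by positivity)]
    have : (0 : ℝ) ≤ M * (4 * d + 1) := by positivity
    linarith
  have hc2 : ∀ M, 2 * d * c M ≤ 1 := fun M => by
    have := hc4 M
    have : 0 ≤ c M * d := mul_nonneg (hcpos M).le d.cast_nonneg
    linarith
  have hclim : Filter.Tendsto c Filter.atTop (nhds 0) := by
    have := tendsto_one_div_add_atTop_nhds_zero_nat (𝕜 := ℝ)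
    simpa [hc, div_eq_mul_inv, mul_comm] using this.mul_const (1 / (4 * (d : ℝ) + 1))
  set a : ℕ → ℂ := fun M => ((2 * c M : ℝ) : ℂ) ^ (-(Complex.I * (t : ℂ))) with ha
  have ha1 : ∀ M, ‖a M‖ = 1 := fun M => by
    simp only [ha]
    rw [Complex.norm_cpow_eq_rpow_re_of_pos (by linarith [hcpos M])]
    simp
  set P : ℕ → ℕ → (Fin d → ℝ) → ℂ := fun M N ξ => ∑ j ∈ Finset.range N,
    (a M * imagPowerCoeff t j) * (((1 - c M * laplacianSymbol d ξ : ℝ) : ℂ) ^ (2 * j)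
        - ((1 - c M * laplacianSymbol d ξ : ℝ) : ℂ) ^ (2 * (j + 1))) with hP
  have hPmeas : ∀ M N, Measurable (P M N) := fun M N => Continuous.measurable (by fun_prop)
  have hPK : ∀ M N, ‖∑' n, Tmult d (P M N) (fun n => (f n : ℂ)) n * h n‖ ≤ K := fun M N => by
    rw [hP, tsum_Tmult_partial_sum (hcpos M).le (hc2 M) hfs' hhs]
    exact hbound (lazyWeight d (c M)) (lazyStep d) (lazyReverse d) (lazyWeight_reverse (c M))
      lazyStep_reverse (lazyWeight_nonneg (hcpos M).le (hc2 M)) (sum_lazyWeight (c M)) f h hf hh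
      hhs (summable_rpow_of_summable hp.le hf hfs) _ (A + 1)
      (fun j => by rw [norm_mul, ha1, one_mul]; linarith [hA j]) N
  set Q : ℕ → (Fin d → ℝ) → ℂ := fun M ξ =>
    a M * ((1 - (1 - c M * laplacianSymbol d ξ) ^ 2 : ℝ) : ℂ) ^ (Complex.I * (t : ℂ)) with hQ
  have hPsum : ∀ M N ξ, P M N ξ = a M * ∑ j ∈ Finset.range N, imagPowerCoeff t j *
      (((1 - c M * laplacianSymbol d ξ : ℝ) : ℂ) ^ (2 * j)
        - ((1 - c M * laplacianSymbol d ξ : ℝ) : ℂ) ^ (2 * (j + 1))) := fun M N ξ => by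
    simp only [hP, Finset.mul_sum, mul_assoc]
  have hPQ : ∀ M ξ, Filter.Tendsto (fun N => P M N ξ) Filter.atTop (nhds (Q M ξ)) := fun M ξ => by
    simp only [hPsum]
    exact (tendsto_sum_imagPowerCoeff ht (abs_lazySymbol_le (hcpos M).le (hc2 M) ξ)).const_mul _
  have hQmeas : ∀ M, Measurable (Q M) := fun M =>
    measurable_of_tendsto_metrizable (hPmeas M) (tendsto_pi_nhds.2 (hPQ M))
  have hQK : ∀ M, ‖∑' n, Tmult d (Q M) (fun n => (f n : ℂ)) n * h n‖ ≤ K := fun M => by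
    refine norm_tsum_mul_le_of_tendsto hhs' (fun n => tendsto_Tmult (B := A) (hPmeas M)
      (Filter.Eventually.of_forall fun N ξ => ?_) (hPQ M) hfs' n) (hPK M)
    rw [hPsum, norm_mul, ha1, one_mul]
    exact norm_sum_imagPowerCoeff_le hA (abs_lazySymbol_le (hcpos M).le (hc2 M) ξ) N
  refine norm_tsum_mul_le_of_tendsto hhs' (fun n => tendsto_Tmult (B := 1) hQmeas
    (Filter.Eventually.of_forall fun M ξ => ?_) (fun ξ => ?_) hfs' n) hQK
  · simp only [hQ]
    rw [norm_mul, ha1, one_mul]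
    refine norm_cpow_I_mul_le _ _ (sub_nonneg.2 ((sq_le_one_iff_abs_le_one _).2 ?_))
    exact abs_lazySymbol_le (hcpos M).le (hc2 M) ξ
  · refine tendsto_imagPower_approx t (laplacianSymbol d ξ) (laplacianSymbol_nonneg ξ) hcpos
      (fun M => ?_) hclim
    exact (mul_le_mul_of_nonneg_left (laplacianSymbol_le ξ) (hcpos M).le).trans (hc4 M)

end DiscreteLaplacian

section ComplexValued

/-- The directions `1, -1, I, -I` of the half-axes of the complex plane. -/
def axisDirection : Fin 4 → ℂ := ![1, -1, Complex.I, -Complex.I]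

/-- The nonnegative component of a complex number along each of the directions
`1, -1, I, -I`. -/
noncomputable def axisPart (k : Fin 4) (z : ℂ) : ℝ :=
  ![max z.re 0, max (-z.re) 0, max z.im 0, max (-z.im) 0] k

lemma norm_axisDirection (k : Fin 4) : ‖axisDirection k‖ = 1 := by
  fin_cases k <;> simp [axisDirection]

lemma axisPart_nonneg (k : Fin 4) (z : ℂ) : 0 ≤ axisPart k z := by
  fin_cases k <;> simp [axisPart]

lemma axisPart_le_norm (k : Fin 4) (z : ℂ) : axisPart k z ≤ ‖z‖ := by
  have h1 := abs_le.1 (Complex.abs_re_le_norm z)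
  have h2 := abs_le.1 (Complex.abs_im_le_norm z)
  fin_cases k <;> simp [axisPart] <;> linarith [h1.1, h1.2, h2.1, h2.2]

lemma sum_axisDirection_mul_axisPart (z : ℂ) :
    ∑ k, axisDirection k * (axisPart k z : ℂ) = z := by
  have h : ∀ x : ℝ, max x 0 - max (-x) 0 = x := fun x => by
    simp
  simp only [Fin.sum_univ_four, axisDirection, axisPart]
  apply Complex.ext
  · simpa [sub_eq_add_neg] using h z.re
  · simpa [sub_eq_add_neg] using h z.im

lemma axisPart_zero (k : Fin 4) : axisPart k 0 = 0 :=
  le_antisymm ((axisPart_le_norm k 0).trans_eq norm_zero) (axisPart_nonneg k 0)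

lemma tsum_axisPart_rpow_le {α : Type*} {f : α → ℂ} {p : ℝ} (hp : 0 ≤ p)
    (hf : Summable fun n => ‖f n‖ ^ p) (k : Fin 4) :
    ∑' n, axisPart k (f n) ^ p ≤ ∑' n, ‖f n‖ ^ p := by
  have h : ∀ n, axisPart k (f n) ^ p ≤ ‖f n‖ ^ p := fun n =>
    rpow_le_rpow (axisPart_nonneg k _) (axisPart_le_norm k _) hp
  exact (Summable.of_nonneg_of_le (fun n => rpow_nonneg (axisPart_nonneg k _) p) h hf).tsum_le_tsum
    h hf

lemma norm_imagPowerSymbol_le {d : ℕ} (t : ℝ) (ξ : Fin d → ℝ) : ‖imagPowerSymbol d t ξ‖ ≤ 1 :=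
  norm_cpow_I_mul_le _ t (laplacianSymbol_nonneg ξ)

lemma measurable_imagPowerSymbol (d : ℕ) (t : ℝ) : Measurable (imagPowerSymbol d t) := by
  unfold imagPowerSymbol
  exact Measurable.pow_const (Continuous.measurable (by fun_prop)) _

lemma exists_norm_tsum_Tmult_le (d : ℕ) {t : ℝ} (ht : t ≠ 0) {p : ℝ} (hp : 1 < p) :
    ∃ C : ℝ, 0 < C ∧ ∀ f h : (Fin d → ℤ) → ℂ, Summable (fun n => ‖f n‖) → h.support.Finite →
      ‖∑' n, Tmult d (imagPowerSymbol d t) f n * h n‖ ≤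
        C * (∑' n, ‖f n‖ ^ p + ∑' n, ‖h n‖ ^ (p / (p - 1))) := by
  obtain ⟨C, hC, hbound⟩ := exists_norm_tsum_Tmult_le_of_nonneg d ht hp
  refine ⟨16 * C, by positivity, fun f h hf hh => ?_⟩
  have hq : 0 < p / (p - 1) := div_pos (by linarith) (by linarith)
  have hfk : ∀ k, Summable fun n => axisPart k (f n) := fun k =>
    Summable.of_nonneg_of_le (fun n => axisPart_nonneg k _) (fun n => axisPart_le_norm k _) hf
  have hhk : ∀ l, (fun n => axisPart l (h n)).support.Finite := fun l =>
    hh.subset fun n hn h0 => hn (by simp only [h0, axisPart_zero])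
  have hT : ∀ n, Tmult d (imagPowerSymbol d t) f n = ∑ k, axisDirection k *
      Tmult d (imagPowerSymbol d t) (fun n => (axisPart k (f n) : ℂ)) n := fun n => by
    rw [← Tmult_sum_function Finset.univ axisDirection (fun k n => (axisPart k (f n) : ℂ))
      (measurable_imagPowerSymbol d t) (norm_imagPowerSymbol_le t)
      (fun k => by simpa only [Complex.norm_real] using (hfk k).norm)]
    simp only [sum_axisDirection_mul_axisPart]
  have hsum : ∑' n, Tmult d (imagPowerSymbol d t) f n * h n =
      ∑ k, ∑ l, axisDirection k * axisDirection l *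
        ∑' n, Tmult d (imagPowerSymbol d t) (fun n => (axisPart k (f n) : ℂ)) n *
          axisPart l (h n) := by
    have e : ∀ g u : (Fin d → ℤ) → ℂ, (∀ n, h n = 0 → u n = 0) →
        ∑' n, g n * u n = ∑ n ∈ hh.toFinset, g n * u n := fun g u hu =>
      tsum_eq_sum fun n hn => by rw [hu n (by simpa using hn), mul_zero]
    have e' : ∀ (g : (Fin d → ℤ) → ℂ) (l : Fin 4), ∑' n, g n * (axisPart l (h n) : ℂ) =
        ∑ n ∈ hh.toFinset, g n * (axisPart l (h n) : ℂ) := fun g l =>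
      e g (fun n => (axisPart l (h n) : ℂ)) fun n hn => by rw [hn, axisPart_zero, ofReal_zero]
    rw [e _ _ fun n => id]
    simp only [e', Finset.mul_sum]
    rw [Finset.sum_congr rfl fun k _ => Finset.sum_comm, Finset.sum_comm]
    refine Finset.sum_congr rfl fun n _ => ?_
    rw [hT n, ← sum_axisDirection_mul_axisPart (h n), Finset.sum_mul_sum]
    refine Finset.sum_congr rfl fun k _ => Finset.sum_congr rfl fun l _ => ?_
    rw [sum_axisDirection_mul_axisPart]
    ring
  have hkl : ∀ k l, ‖axisDirection k * axisDirection l *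
      ∑' n, Tmult d (imagPowerSymbol d t) (fun n => (axisPart k (f n) : ℂ)) n *
          axisPart l (h n)‖ ≤ C * (∑' n, ‖f n‖ ^ p + ∑' n, ‖h n‖ ^ (p / (p - 1))) := fun k l => by
    rw [norm_mul, norm_mul, norm_axisDirection, norm_axisDirection, one_mul, one_mul]
    refine (hbound _ _ (fun n => axisPart_nonneg k _) (fun n => axisPart_nonneg l _) (hfk k)
      (hhk l)).trans (mul_le_mul_of_nonneg_left (add_le_add ?_ ?_) hC.le)
    · exact tsum_axisPart_rpow_le (by linarith)
        (summable_rpow_of_summable hp.le (fun n => norm_nonneg _) hf) k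
    · refine tsum_axisPart_rpow_le hq.le (summable_of_hasFiniteSupport (hh.subset ?_)) l
      intro n hn h0
      exact hn (by simp [h0, hq.ne'])
  rw [hsum]
  refine (norm_sum_le _ _).trans ((Finset.sum_le_sum fun k _ => (norm_sum_le _ _).trans
    (Finset.sum_le_sum fun l _ => hkl k l)).trans_eq ?_)
  simp only [Finset.sum_const, Finset.card_univ, Fintype.card_fin, nsmul_eq_mul]
  push_cast
  ring

/-- A weak-type duality bound, additive in the norms, controls `p`-th power sums. -/
lemma exists_sum_norm_rpow_le {p C : ℝ} (hp : 1 < p) (hC : 0 < C) :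
    ∃ K : ℝ, 0 < K ∧ ∀ (α : Type) (g : α → ℂ) (S : ℝ),
      (∀ h : α → ℂ, h.support.Finite →
        ‖∑' n, g n * h n‖ ≤ C * (S + ∑' n, ‖h n‖ ^ (p / (p - 1)))) →
      ∀ s : Finset α, ∑ n ∈ s, ‖g n‖ ^ p ≤ K * S := by
  classical
  have hp1 : 0 < p - 1 := by linarith
  set q := p / (p - 1) with hq
  have hq0 : 0 < q := div_pos (by linarith) hp1
  set ε := (2 * C) ^ (-(p - 1)) with hε
  have hε0 : 0 < ε := rpow_pos_of_pos (by linarith) _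
  have hCε : C * ε ^ q = ε / 2 := by
    have e1 : q = 1 + (p - 1)⁻¹ := by rw [hq]; field_simp; ring
    have e2 : ε ^ (p - 1)⁻¹ = (2 * C)⁻¹ := by
      rw [hε, ← rpow_mul (by linarith), neg_mul, mul_inv_cancel₀ hp1.ne', rpow_neg_one]
    rw [e1, rpow_add hε0, rpow_one, e2]
    field_simp
  refine ⟨2 * C / ε, by positivity, fun α g S hg s => ?_⟩
  set h : α → ℂ := fun n =>
    if n ∈ s then ((ε * ‖g n‖ ^ (p - 2) : ℝ) : ℂ) * (starRingEnd ℂ) (g n) else 0 with hh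
  have hsupp : ∀ n ∉ s, h n = 0 := fun n hn => if_neg hn
  have hfin : h.support.Finite := s.finite_toSet.subset fun n hn => by
    by_contra hns
    exact hn (hsupp n hns)
  have hgh : ∀ n ∈ s, g n * h n = ((ε * ‖g n‖ ^ p : ℝ) : ℂ) := fun n hn => by
    simp only [hh, if_pos hn]
    rw [mul_left_comm, Complex.mul_conj, ← Complex.ofReal_mul, Complex.normSq_eq_norm_sq]
    congr 1
    rcases (norm_nonneg (g n)).eq_or_lt with h0 | h0
    · simp [← h0, (by linarith : p ≠ 0)]
    · rw [mul_assoc, ← rpow_natCast, ← rpow_add h0]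
      norm_num
  have hhq : ∀ n ∈ s, ‖h n‖ ^ q = ε ^ q * ‖g n‖ ^ p := fun n hn => by
    simp only [hh, if_pos hn]
    rw [norm_mul, Complex.norm_real, RCLike.norm_conj,
      Real.norm_of_nonneg (mul_nonneg hε0.le (rpow_nonneg (norm_nonneg _) _)), mul_assoc,
      mul_rpow hε0.le (mul_nonneg (rpow_nonneg (norm_nonneg _) _) (norm_nonneg _))]
    congr 1
    rcases (norm_nonneg (g n)).eq_or_lt with h0 | h0
    · simp [← h0, (by linarith : p ≠ 0), hq0.ne']
    · rw [← rpow_add_one h0.ne', ← rpow_mul h0.le, hq]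
      congr 1
      field_simp
      ring
  have key := hg h hfin
  rw [tsum_eq_sum fun n hn => by rw [hsupp n hn, mul_zero], Finset.sum_congr rfl hgh,
    tsum_eq_sum fun n hn => by rw [hsupp n hn, norm_zero, zero_rpow hq0.ne'],
    Finset.sum_congr rfl hhq, ← Complex.ofReal_sum, ← Finset.mul_sum, ← Finset.mul_sum,
    Complex.norm_real] at key
  have hle := (le_abs_self _).trans key
  rw [mul_add, ← mul_assoc, hCε] at hle
  rw [div_mul_eq_mul_div, le_div_iff₀ hε0]
  linarith

lemma lpNorm_eq_tsum (d : ℕ) (f : (Fin d → ℤ) → ℂ) {p : ℝ} (hp : 0 < p) :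
    lpNorm d f p = (∑' n, ENNReal.ofReal (‖f n‖ ^ p)) ^ (1 / p) := by
  unfold _root_.lpNorm
  rw [eLpNorm_eq_lintegral_rpow_enorm_toReal (by simpa using hp) ENNReal.ofReal_ne_top,
    ENNReal.toReal_ofReal hp.le, lintegral_count]
  congr 1
  refine tsum_congr fun n => ?_
  rw [← ofReal_norm, ENNReal.ofReal_rpow_of_nonneg (norm_nonneg _) hp.le]

lemma lpNorm_le_of_sum_le {d : ℕ} {f g : (Fin d → ℤ) → ℂ} {p K : ℝ} (hp : 1 < p) (hK : 0 ≤ K)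
    (hf : Summable fun n => ‖f n‖)
    (h : ∀ s : Finset (Fin d → ℤ), ∑ n ∈ s, ‖g n‖ ^ p ≤ K * ∑' n, ‖f n‖ ^ p) :
    lpNorm d g p ≤ ENNReal.ofReal (K ^ (1 / p)) * lpNorm d f p := by
  have hp0 : 0 < p := by linarith
  rw [lpNorm_eq_tsum d g hp0, lpNorm_eq_tsum d f hp0,
    ← ENNReal.ofReal_rpow_of_nonneg hK (by positivity), ← ENNReal.mul_rpow_of_nonneg _ _
    (by positivity)]
  refine ENNReal.rpow_le_rpow ?_ (by positivity)
  rw [← ENNReal.ofReal_tsum_of_nonneg (fun n => rpow_nonneg (norm_nonneg (f n)) p)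
    (summable_rpow_of_summable hp.le (fun n => norm_nonneg _) hf), ← ENNReal.ofReal_mul hK,
    ENNReal.tsum_eq_iSup_sum]
  refine iSup_le fun s => ?_
  rw [← ENNReal.ofReal_sum_of_nonneg fun n _ => rpow_nonneg (norm_nonneg (g n)) p]
  exact ENNReal.ofReal_le_ofReal (h s)

end ComplexValued

/-- For every `t ∈ ℝ`, the imaginary power `(−Δ_d)^{it}`, the Fourier multiplier operator
with symbol `(4 Σ_j sin²(πξ_j))^{it}`, is bounded on `ℓ^p(ℤ^d)` for all `1 < p < ∞`. -/
theorem stmt_18 (d : ℕ) (t : ℝ) :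
    ∀ p : ℝ, 1 < p →
      ∃ C : ℝ, 0 < C ∧ ∀ f : (Fin d → ℤ) → ℂ, Summable (fun n => ‖f n‖) →
        lpNorm d (Tmult d (imagPowerSymbol d t) f) p ≤ ENNReal.ofReal C * lpNorm d f p := by
  intro p hp
  by_cases ht : t = 0
  · refine ⟨1, one_pos, fun f hf => ?_⟩
    have h1 : imagPowerSymbol d t = fun _ => 1 := by
      ext ξ
      simp [imagPowerSymbol, ht]
    rw [h1, funext (Tmult_one hf), ENNReal.ofReal_one, one_mul]
  · obtain ⟨C, hC, hbound⟩ := exists_norm_tsum_Tmult_le d ht hp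
    obtain ⟨K, hK, hKbound⟩ := exists_sum_norm_rpow_le hp hC
    exact ⟨K ^ (1 / p), rpow_pos_of_pos hK _, fun f hf => lpNorm_le_of_sum_le hp hK.le hf
      (hKbound _ _ _ fun h hh => hbound f h hf hh)⟩
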